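/- arXiv:1912.00644 — 3 statements merged into one kernel-verified Lean document; each statement's English description precedes it below -/
import Mathlib

section
/- Let G_1, …, G_N be complex matrices (G_k of size p_k × m_k), let E = (e_{kl}) be an N×N non-negative real matrix, and let Δ = (Δ_{kl}) be a block matrix with blocks Δ_{kl} ∈ ℂ^{m_k × p_l}. Define the block matrix M with blocks M_{kl} = e_{kl} G_k Δ_{kl} ∈ ℂ^{p_k × p_l}. If λ is an eigenvalue of M, then |λ|² ≤ ‖Δ‖² · ρ(D E^{∘2}), where D = diag(‖G_1‖², …, ‖G_N‖²) (operator norms), E^{∘2} is the entrywise square of E, and ‖Δ‖ = max_k ‖[Δ_{k1}, …, Δ_{kN}]‖ is the maximum of the operator norms of the block rows of Δ with respect to the norms ‖y‖² = Σ‖y_l‖² on the domain and the given norm on ℂ^{m_k}. -/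
open scoped ENNReal

section Collatz

attribute [local instance] Matrix.linftyOpNormedRing Matrix.linftyOpNormedAlgebra

variable {n : Type*} [Fintype n] [DecidableEq n]

/-- Iterating a sub-invariance inequality `c x ≤ d A x` for a nonnegative matrix `A`. -/
lemma pow_mul_le_pow_mul_pow_mulVec {A : Matrix n n ℝ} (hA : ∀ i j, 0 ≤ A i j) {x : n → ℝ}
    {c d : ℝ} (hc : 0 ≤ c) (hd : 0 ≤ d) (h : ∀ i, c * x i ≤ d * (A.mulVec x) i) (k : ℕ) (i : n) :
    c ^ k * x i ≤ d ^ k * ((A ^ k).mulVec x) i := by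
  induction k generalizing i with
  | zero => simp
  | succ k ih =>
    calc c ^ (k + 1) * x i = c ^ k * (c * x i) := by ring
      _ ≤ c ^ k * (d * (A.mulVec x) i) := mul_le_mul_of_nonneg_left (h i) (by positivity)
      _ = d * ∑ j, A i j * (c ^ k * x j) := by
        simp only [Matrix.mulVec, dotProduct, Finset.mul_sum]
        exact Finset.sum_congr rfl fun j _ => by ring
      _ ≤ d * ∑ j, A i j * (d ^ k * ((A ^ k).mulVec x) j) := by
        exact mul_le_mul_of_nonneg_left
          (Finset.sum_le_sum fun j _ => mul_le_mul_of_nonneg_left (ih j) (hA i j)) hd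
      _ = d ^ (k + 1) * ((A ^ (k + 1)).mulVec x) i := by
        rw [pow_succ' A, ← Matrix.mulVec_mulVec]
        simp only [Matrix.mulVec.eq_1 A, dotProduct, Finset.mul_sum]
        exact Finset.sum_congr rfl fun j _ => by ring

lemma linfty_opNNNorm_map_ofReal (A : Matrix n n ℝ) : ‖A.map Complex.ofReal‖₊ = ‖A‖₊ := by
  simp [Matrix.linfty_opNNNorm_def]

/-- A Collatz–Wielandt lower bound for the spectral radius of a nonnegative matrix. -/
lemma ofReal_le_mul_spectralRadius_of_mul_le_mulVec {A : Matrix n n ℝ} (hA : ∀ i j, 0 ≤ A i j)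
    {x : n → ℝ} (hx : ∀ i, 0 ≤ x i) (hx0 : x ≠ 0) {c d : ℝ} (hc : 0 ≤ c) (hd : 0 ≤ d)
    (h : ∀ i, c * x i ≤ d * (A.mulVec x) i) :
    ENNReal.ofReal c ≤ ENNReal.ofReal d * spectralRadius ℂ (A.map Complex.ofReal) := by
  have key (k : ℕ) : c ^ k ≤ d ^ k * ‖A ^ k‖ := by
    have hxpos : 0 < ‖x‖ := norm_pos_iff.mpr hx0
    refine le_of_mul_le_mul_right ?_ hxpos
    calc c ^ k * ‖x‖ = ‖c ^ k • x‖ := by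
          rw [norm_smul, Real.norm_of_nonneg (pow_nonneg hc k)]
      _ ≤ d ^ k * ‖(A ^ k).mulVec x‖ := by
          refine (pi_norm_le_iff_of_nonneg (by positivity)).mpr fun i => ?_
          rw [Pi.smul_apply, smul_eq_mul, Real.norm_of_nonneg (mul_nonneg (by positivity) (hx i))]
          refine (pow_mul_le_pow_mul_pow_mulVec hA hc hd h k i).trans ?_
          gcongr
          exact (le_abs_self _).trans (norm_le_pi_norm ((A ^ k).mulVec x) i)
      _ ≤ d ^ k * (‖A ^ k‖ * ‖x‖) := by
          gcongr
          exact Matrix.linfty_opNorm_mulVec _ _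
      _ = d ^ k * ‖A ^ k‖ * ‖x‖ := by ring
  have : CompleteSpace (Matrix n n ℂ) := FiniteDimensional.complete ℂ _
  have lim := ENNReal.Tendsto.const_mul
    (spectrum.pow_nnnorm_pow_one_div_tendsto_nhds_spectralRadius (A.map Complex.ofReal))
    (Or.inr (ENNReal.ofReal_ne_top (r := d)))
  refine ge_of_tendsto lim ?_
  filter_upwards [Filter.eventually_gt_atTop 0] with k hk
  have hmap : A.map Complex.ofReal ^ k = (A ^ k).map Complex.ofReal :=
    (map_pow (Complex.ofRealHom.mapMatrix) A k).symm
  rw [hmap, linfty_opNNNorm_map_ofReal]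
  have hk' : (0 : ℝ) < k := by exact_mod_cast hk
  have hpow : ENNReal.ofReal c ^ k ≤ ENNReal.ofReal d ^ k * ‖A ^ k‖₊ := by
    have := ENNReal.ofReal_le_ofReal (key k)
    rwa [ENNReal.ofReal_mul (by positivity), ENNReal.ofReal_pow hc, ENNReal.ofReal_pow hd,
      ofReal_norm] at this
  calc ENNReal.ofReal c = (ENNReal.ofReal c ^ k) ^ (1 / k : ℝ) := by
        rw [one_div, ENNReal.pow_rpow_inv_natCast hk.ne']
    _ ≤ (ENNReal.ofReal d ^ k * ‖A ^ k‖₊) ^ (1 / k : ℝ) := by gcongr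
    _ = ENNReal.ofReal d * (‖A ^ k‖₊ : ℝ≥0∞) ^ (1 / k : ℝ) := by
        rw [ENNReal.mul_rpow_of_nonneg _ _ (by positivity), one_div,
          ENNReal.pow_rpow_inv_natCast hk.ne']

end Collatz

/-- Eigenvalue bound for a block matrix `M` with blocks `M_{kl} = e_{kl} G_k Δ_{kl}`:
any eigenvalue `μ` of `M` satisfies `|μ|² ≤ ‖Δ‖² · ρ(D E^{∘2})`, where
`D = diag(‖G_k‖²)`, `(E^{∘2})_{kl} = e_{kl}²` and `‖Δ‖ = max_k` of the operator norms
of the block rows of `Δ`. -/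
theorem eigenvalue_bound_block_matrix
    {N : ℕ} (hN : 0 < N) (p m : Fin N → ℕ)
    (G : ∀ k, EuclideanSpace ℂ (Fin (m k)) →L[ℂ] EuclideanSpace ℂ (Fin (p k)))
    (e : Fin N → Fin N → ℝ) (he : ∀ k l, 0 ≤ e k l)
    (Δ : ∀ k l, EuclideanSpace ℂ (Fin (p l)) →L[ℂ] EuclideanSpace ℂ (Fin (m k)))
    (Δrow : ∀ k, (PiLp 2 fun l => EuclideanSpace ℂ (Fin (p l))) →L[ℂ]
      EuclideanSpace ℂ (Fin (m k)))
    (hrow : ∀ k (y : PiLp 2 fun l => EuclideanSpace ℂ (Fin (p l))),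
      Δrow k y = ∑ l, Δ k l (y l))
    (μ : ℂ) (y : PiLp 2 fun l => EuclideanSpace ℂ (Fin (p l))) (hy : y ≠ 0)
    (heig : ∀ k, μ • y k = ∑ l, ((e k l : ℂ)) • (G k) ((Δ k l) (y l))) :
    ENNReal.ofReal (‖μ‖ ^ 2) ≤
      ENNReal.ofReal ((⨆ k, ‖Δrow k‖) ^ 2) *
        spectralRadius ℂ
          ((Matrix.of fun k l : Fin N => ‖G k‖ ^ 2 * (e k l) ^ 2).map (Complex.ofReal)) := by
  refine ofReal_le_mul_spectralRadius_of_mul_le_mulVec (x := fun k => ‖y k‖ ^ 2)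
    (fun k l => by simp only [Matrix.of_apply]; positivity) (fun k => by positivity) ?_
    (by positivity) (by positivity) fun k => ?_
  · refine fun h0 => hy ?_
    ext1 k
    simpa using congrFun h0 k
  let z : PiLp 2 fun l => EuclideanSpace ℂ (Fin (p l)) :=
    WithLp.toLp 2 fun l => (e k l : ℂ) • y l
  have hz : ‖z‖ ^ 2 = ∑ l, e k l ^ 2 * ‖y l‖ ^ 2 := by
    simp [z, PiLp.norm_sq_eq_of_L2, norm_smul, mul_pow]
  have hμ : μ • y k = G k (Δrow k z) := by
    simp [heig, hrow, z]
  have hsup : ‖Δrow k‖ ≤ ⨆ k, ‖Δrow k‖ :=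
    le_ciSup (f := fun k => ‖Δrow k‖) (Set.finite_range _).bddAbove k
  have hle : ‖μ‖ * ‖y k‖ ≤ ‖G k‖ * ((⨆ k, ‖Δrow k‖) * ‖z‖) := by
    rw [← norm_smul, hμ]
    refine (G k).le_opNorm_of_le ((Δrow k).le_of_opNorm_le hsup z)
  calc ‖μ‖ ^ 2 * ‖y k‖ ^ 2 = (‖μ‖ * ‖y k‖) ^ 2 := by ring
    _ ≤ (‖G k‖ * ((⨆ k, ‖Δrow k‖) * ‖z‖)) ^ 2 := by gcongr
    _ = (⨆ k, ‖Δrow k‖) ^ 2 * (‖G k‖ ^ 2 * ‖z‖ ^ 2) := by ring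
    _ = _ := by
      rw [hz]
      simp only [Matrix.mulVec, dotProduct, Matrix.of_apply, Finset.mul_sum, mul_assoc]
end

section
/- The Laplace transform, sending f ∈ L²([0,∞); H) to f̂(s) = ∫₀^∞ f(t) e^{-st} dt for Re s > 0, is an isometric isomorphism from L²([0,∞); H) onto the Hardy space H²(ℂ₊; H) (with the normalization ‖f̂‖² = sup_{x>0} (1/2π) ∫_ℝ ‖f̂(x+iω)‖² dω). -/
open MeasureTheory Filter
open scoped ENNReal NNReal

theorem MeasureTheory.Lp.lintegral_enorm_sq {α E : Type*} [MeasurableSpace α]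
    {μ : Measure α} [NormedAddCommGroup E] (g : Lp E 2 μ) :
    ∫⁻ x, ‖g x‖ₑ ^ 2 ∂μ = ‖g‖ₑ ^ 2 := by
  rw [Lp.enorm_def, eLpNorm_eq_lintegral_rpow_enorm_toReal (by simp) (by simp),
    ← ENNReal.rpow_natCast, ← ENNReal.rpow_mul]
  simp

theorem memLp_two_iff_lintegral {α E : Type*} [MeasurableSpace α] {μ : Measure α}
    [NormedAddCommGroup E] {f : α → E} :
    MemLp f 2 μ ↔ AEStronglyMeasurable f μ ∧ ∫⁻ t, ‖f t‖ₑ ^ 2 ∂μ < ⊤ := by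
  refine and_congr_right fun _ ↦ ?_
  rw [eLpNorm_lt_top_iff_lintegral_rpow_enorm_lt_top (by simp) (by simp)]
  simp

section Plancherel

open FourierTransform SchwartzMap
open scoped ContDiff

variable {H : Type*} [NormedAddCommGroup H] [InnerProductSpace ℂ H]

theorem Continuous.ae_eq_of_integral_schwartzMap_smul_eq [CompleteSpace H] {g k : ℝ → H}
    (hk : Continuous k) (hg : LocallyIntegrable g)
    (h : ∀ φ : 𝓢(ℝ, ℂ), ∫ x, φ x • g x = ∫ x, φ x • k x) : g =ᵐ[volume] k := by
  refine ae_eq_of_integral_contDiff_smul_eq hg hk.locallyIntegrable fun φ hφ hc ↦ ?_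
  have hc' : HasCompactSupport (Complex.ofRealCLM ∘ φ) := hc.comp_left rfl
  have hφ' : ContDiff ℝ ∞ (Complex.ofRealCLM ∘ φ) := by fun_prop
  simpa using h (hc'.toSchwartzMap hφ')

variable {f : ℝ → H}

theorem MeasureTheory.Integrable.continuous_fourier (hf : Integrable f) : Continuous (𝓕 f) :=
  VectorFourier.fourierIntegral_continuous Real.continuous_fourierChar
    (by exact continuous_inner) hf

theorem MeasureTheory.Integrable.continuous_fourierInv (hf : Integrable f) :
    Continuous (𝓕⁻ f) := by
  rw [funext (Real.fourierInv_eq_fourier_neg f)]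
  exact hf.continuous_fourier.comp continuous_neg

variable [CompleteSpace H]

/-- The `L²` Fourier transform agrees with the Fourier integral on `L¹ ∩ L²`. -/
theorem MeasureTheory.MemLp.coeFn_fourier_toLp (hf : MemLp f 2) (hf' : Integrable f) :
    (𝓕 (hf.toLp f) : Lp (α := ℝ) H 2) =ᵐ[volume] 𝓕 f := by
  refine hf'.continuous_fourier.ae_eq_of_integral_schwartzMap_smul_eq
    ((Lp.memLp _).locallyIntegrable one_le_two) fun φ ↦ ?_
  have h := congrArg (fun T : 𝓢'(ℝ, H) ↦ T φ)
    (Lp.fourier_toTemperedDistribution_eq (hf.toLp f))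
  simp only [TemperedDistribution.fourier_apply, Lp.toTemperedDistribution_apply] at h
  rw [← h, integral_congr_ae (g := fun x ↦ 𝓕 φ x • f x)
    (by filter_upwards [hf.coeFn_toLp] with x hx; rw [hx])]
  simpa [SchwartzMap.fourier_coe] using!
    VectorFourier.integral_fourierIntegral_smul_eq_flip (L := innerₗ ℝ)
      Real.continuous_fourierChar continuous_inner φ.integrable hf'

/-- The inverse `L²` Fourier transform agrees with the inverse Fourier integral on `L¹ ∩ L²`. -/
theorem MeasureTheory.MemLp.coeFn_fourierInv_toLp (hf : MemLp f 2) (hf' : Integrable f) :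
    (𝓕⁻ (hf.toLp f) : Lp (α := ℝ) H 2) =ᵐ[volume] 𝓕⁻ f := by
  refine hf'.continuous_fourierInv.ae_eq_of_integral_schwartzMap_smul_eq
    ((Lp.memLp _).locallyIntegrable one_le_two) fun φ ↦ ?_
  have h := congrArg (fun T : 𝓢'(ℝ, H) ↦ T φ)
    (Lp.fourierInv_toTemperedDistribution_eq (hf.toLp f))
  simp only [TemperedDistribution.fourierInv_apply, Lp.toTemperedDistribution_apply] at h
  rw [← h, integral_congr_ae (g := fun x ↦ 𝓕⁻ φ x • f x)
    (by filter_upwards [hf.coeFn_toLp] with x hx; rw [hx])]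
  simpa [SchwartzMap.fourierInv_coe, Real.fourierInv_eq, VectorFourier.fourierIntegral,
    mul_comm] using!
    VectorFourier.integral_fourierIntegral_smul_eq_flip (L := -innerₗ ℝ)
      Real.continuous_fourierChar continuous_inner.neg (φ.integrable (μ := volume)) hf'

theorem MeasureTheory.MemLp.lintegral_enorm_fourier_sq (hf : MemLp f 2) (hf' : Integrable f) :
    ∫⁻ ξ, ‖𝓕 f ξ‖ₑ ^ 2 = ∫⁻ t, ‖f t‖ₑ ^ 2 := by
  have h1 : ∫⁻ ξ, ‖𝓕 f ξ‖ₑ ^ 2 = ∫⁻ ξ, ‖(𝓕 (hf.toLp f) : Lp H 2 (volume : Measure ℝ)) ξ‖ₑ ^ 2 :=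
    lintegral_congr_ae (by filter_upwards [hf.coeFn_fourier_toLp hf'] with ξ h; rw [h])
  have h2 : ∫⁻ t, ‖f t‖ₑ ^ 2 = ∫⁻ t, ‖(hf.toLp f : Lp H 2 (volume : Measure ℝ)) t‖ₑ ^ 2 :=
    lintegral_congr_ae (by filter_upwards [hf.coeFn_toLp] with t h; rw [h])
  rw [h1, h2, Lp.lintegral_enorm_sq, Lp.lintegral_enorm_sq, ← ofReal_norm, ← ofReal_norm,
    Lp.norm_fourier_eq]

theorem MeasureTheory.MemLp.lintegral_enorm_fourierInv_sq (hf : MemLp f 2) (hf' : Integrable f) :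
    ∫⁻ ξ, ‖𝓕⁻ f ξ‖ₑ ^ 2 = ∫⁻ t, ‖f t‖ₑ ^ 2 := by
  rw [← hf.lintegral_enorm_fourier_sq hf', ← lintegral_neg_eq_self (fun ξ ↦ ‖𝓕 f ξ‖ₑ ^ 2)]
  simp_rw [Real.fourierInv_eq_fourier_neg]

end Plancherel

theorem lintegral_two_pi_comp_mul (G : ℝ → ℝ≥0∞) :
    ENNReal.ofReal (2 * Real.pi) * ∫⁻ ξ, G (2 * Real.pi * ξ) = ∫⁻ ω, G ω := by
  have h : (2 * Real.pi) ≠ 0 := Real.two_pi_pos.ne'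
  conv_rhs => rw [← Real.smul_map_volume_mul_left h]
  rw [lintegral_smul_measure, abs_of_pos Real.two_pi_pos, smul_eq_mul]
  exact congrArg _ ((Homeomorph.mulLeft₀ _ h).measurableEmbedding.lintegral_map G).symm

theorem MeasureTheory.MemLp.integrableOn_exp_neg_mul_norm {E : Type*} [NormedAddCommGroup E]
    {f : ℝ → E} (hf : MemLp f 2 (volume.restrict (Set.Ioi 0))) {x : ℝ} (hx : 0 < x) :
    IntegrableOn (fun t ↦ Real.exp (-x * t) * ‖f t‖) (Set.Ioi 0) := by
  refine MemLp.integrable_mul (p := 2) (q := 2) ?_ hf.norm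
  refine (memLp_two_iff_integrable_sq (by fun_prop)).2 ?_
  refine (exp_neg_integrableOn_Ioi 0 (b := 2 * x) (by positivity)).congr_fun (fun t _ ↦ ?_)
    measurableSet_Ioi
  simp only [← Real.exp_nat_mul]
  congr 1; push_cast; ring

section Laplace

open Real FourierTransform

variable {H : Type*} [NormedAddCommGroup H] [InnerProductSpace ℂ H] {f : ℝ → H}

/-- The Laplace transform of `f` restricted to `(0, ∞)`. -/
noncomputable def laplace (f : ℝ → H) (s : ℂ) : H :=
  ∫ t in Set.Ioi (0 : ℝ), Complex.exp (-(s * (t : ℂ))) • f t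

theorem isOpen_re_pos : IsOpen {s : ℂ | 0 < s.re} :=
  isOpen_lt continuous_const Complex.continuous_re

theorem norm_cexp_neg_mul_smul (s : ℂ) (t : ℝ) (v : H) :
    ‖Complex.exp (-(s * t)) • v‖ = exp (-s.re * t) * ‖v‖ := by
  simp [norm_smul, Complex.norm_exp]

theorem norm_cexp_neg_mul_smul_le {x t : ℝ} (hx : 0 ≤ x) (ht : 0 ≤ t) (v : H) :
    ‖Complex.exp (-((x : ℂ) * t)) • v‖ ≤ ‖v‖ := by
  rw [norm_cexp_neg_mul_smul]
  refine mul_le_of_le_one_left (norm_nonneg _) (exp_le_one_iff.2 ?_)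
  simp only [Complex.ofReal_re]
  nlinarith

theorem aestronglyMeasurable_cexp_neg_mul_smul {μ : Measure ℝ} (hf : AEStronglyMeasurable f μ)
    (s : ℂ) : AEStronglyMeasurable (fun t : ℝ ↦ Complex.exp (-(s * t)) • f t) μ :=
  (by fun_prop : Continuous fun t : ℝ ↦ Complex.exp (-(s * t))).aestronglyMeasurable.smul hf

theorem MeasureTheory.MemLp.integrableOn_cexp_smul (hf : MemLp f 2 (volume.restrict (Set.Ioi 0)))
    {s : ℂ} (hs : 0 < s.re) :
    IntegrableOn (fun t : ℝ ↦ Complex.exp (-(s * t)) • f t) (Set.Ioi 0) := by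
  refine (hf.integrableOn_exp_neg_mul_norm hs).mono'
    (aestronglyMeasurable_cexp_neg_mul_smul hf.1 s) (.of_forall fun t ↦ ?_)
  rw [norm_cexp_neg_mul_smul]

theorem MeasureTheory.MemLp.differentiableOn_laplace
    (hf : MemLp f 2 (volume.restrict (Set.Ioi 0))) :
    DifferentiableOn ℂ (laplace f) {s : ℂ | 0 < s.re} := by
  intro s (hs : 0 < s.re)
  refine DifferentiableAt.differentiableWithinAt ?_
  have hU : {z : ℂ | s.re / 2 < z.re} ∈ nhds s :=
    (isOpen_lt continuous_const Complex.continuous_re).mem_nhds (by simpa using hs)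
  refine (hasDerivAt_integral_of_dominated_loc_of_deriv_le
    (F' := fun z (t : ℝ) ↦ Complex.exp (-(z * t)) • (-(t : ℂ) • f t))
    (bound := fun t ↦ (4 / s.re) * (exp (-(s.re / 4) * t) * ‖f t‖)) hU
    (.of_forall fun z ↦ aestronglyMeasurable_cexp_neg_mul_smul hf.1 z)
    (hf.integrableOn_cexp_smul hs) ?_ ?_ ?_ ?_).2.differentiableAt
  · exact aestronglyMeasurable_cexp_neg_mul_smul
      ((by fun_prop : Continuous fun t : ℝ ↦ -(t : ℂ)).aestronglyMeasurable.smul hf.1) s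
  · refine (ae_restrict_iff' measurableSet_Ioi).2 (.of_forall fun t (ht : 0 < t) z hz ↦ ?_)
    have hz : s.re / 2 < z.re := hz
    rw [norm_cexp_neg_mul_smul, norm_smul, norm_neg, Complex.norm_real, norm_of_nonneg ht.le,
      ← mul_assoc, ← mul_assoc]
    refine mul_le_mul_of_nonneg_right ?_ (norm_nonneg _)
    have h1 : t ≤ 4 / s.re * exp (s.re / 4 * t) := by
      have := add_one_le_exp (s.re / 4 * t)
      calc t = 4 / s.re * (s.re / 4 * t) := by field_simp
        _ ≤ _ := by gcongr; linarith
    calc exp (-z.re * t) * t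
        ≤ exp (-(s.re / 2) * t) * (4 / s.re * exp (s.re / 4 * t)) := by gcongr
      _ = 4 / s.re * (exp (-(s.re / 2) * t) * exp (s.re / 4 * t)) := by ring
      _ = _ := by rw [← exp_add]; congr 2; ring
  · exact (hf.integrableOn_exp_neg_mul_norm (x := s.re / 4) (by positivity)).const_mul _
  · refine .of_forall fun t z _ ↦ ?_
    have h : HasDerivAt (fun z : ℂ ↦ Complex.exp (-(z * t)))
        (Complex.exp (-(z * t)) * -(t : ℂ)) z := by
      simpa using ((hasDerivAt_id z).mul_const (t : ℂ)).neg.cexp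
    simpa only [smul_smul] using h.smul_const (f t)

theorem laplace_eq_fourier (f : ℝ → H) (x ξ : ℝ) :
    laplace f (x + (2 * π * ξ : ℝ) * Complex.I) =
      𝓕 ((Set.Ioi 0).indicator fun t : ℝ ↦ Complex.exp (-(x * t)) • f t) ξ := by
  rw [laplace, Real.fourier_real_eq_integral_exp_smul, ← integral_indicator measurableSet_Ioi]
  congr 1 with t
  by_cases ht : t ∈ Set.Ioi (0 : ℝ)
  · simp only [Set.indicator_of_mem ht, smul_smul, ← Complex.exp_add]
    congr 2
    push_cast; ring
  · simp [Set.indicator_of_notMem ht]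

theorem MeasureTheory.MemLp.indicator_cexp_smul (hf : MemLp f 2 (volume.restrict (Set.Ioi 0)))
    {x : ℝ} (hx : 0 < x) :
    MemLp ((Set.Ioi 0).indicator fun t : ℝ ↦ Complex.exp (-(x * t)) • f t) 2 := by
  rw [memLp_indicator_iff_restrict measurableSet_Ioi]
  refine hf.mono (aestronglyMeasurable_cexp_neg_mul_smul hf.1 x)
    ((ae_restrict_iff' measurableSet_Ioi).2 (.of_forall fun t (ht : 0 < t) ↦ ?_))
  exact norm_cexp_neg_mul_smul_le hx.le ht.le _

theorem MeasureTheory.MemLp.integrable_indicator_cexp_smul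
    (hf : MemLp f 2 (volume.restrict (Set.Ioi 0))) {x : ℝ} (hx : 0 < x) :
    Integrable ((Set.Ioi 0).indicator fun t : ℝ ↦ Complex.exp (-(x * t)) • f t) :=
  (hf.integrableOn_cexp_smul (s := x) (by simpa)).integrable_indicator measurableSet_Ioi

theorem MeasureTheory.MemLp.iSup_lintegral_cexp_smul
    (hf : MemLp f 2 (volume.restrict (Set.Ioi 0))) :
    ⨆ x ∈ Set.Ioi (0 : ℝ), ∫⁻ t : ℝ in Set.Ioi 0, ‖Complex.exp (-(x * t : ℂ)) • f t‖ₑ ^ 2 =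
      ∫⁻ t in Set.Ioi (0 : ℝ), ‖f t‖ₑ ^ 2 := by
  have hle (x : ℝ) (hx : 0 < x) : ∀ᵐ t : ℝ ∂volume.restrict (Set.Ioi 0),
      ‖Complex.exp (-((x : ℂ) * t)) • f t‖ₑ ^ 2 ≤ ‖f t‖ₑ ^ 2 := by
    refine (ae_restrict_iff' measurableSet_Ioi).2 (.of_forall fun t (ht : 0 < t) ↦ ?_)
    gcongr ?_ ^ 2
    exact enorm_le_iff_norm_le.2 (norm_cexp_neg_mul_smul_le hx.le ht.le _)
  refine le_antisymm (iSup₂_le fun x hx ↦ lintegral_mono_ae (hle x hx)) ?_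
  have hlim : Tendsto (fun x : ℝ ↦ ∫⁻ t : ℝ in Set.Ioi 0, ‖Complex.exp (-(x * t : ℂ)) • f t‖ₑ ^ 2)
      (nhdsWithin 0 (Set.Ioi 0)) (nhds (∫⁻ t in Set.Ioi (0 : ℝ), ‖f t‖ₑ ^ 2)) := by
    refine tendsto_lintegral_filter_of_dominated_convergence' (fun t ↦ ‖f t‖ₑ ^ 2)
      (.of_forall fun x ↦ (aestronglyMeasurable_cexp_neg_mul_smul hf.1 x).enorm.pow_const 2)
      (eventually_mem_nhdsWithin.mono hle) (memLp_two_iff_lintegral.1 hf).2.ne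
      (.of_forall fun t ↦ ?_)
    have hc : Continuous fun x : ℝ ↦ ‖Complex.exp (-(x * t)) • f t‖ₑ ^ 2 := by fun_prop
    simpa using (hc.tendsto 0).mono_left nhdsWithin_le_nhds
  exact le_of_tendsto hlim (eventually_mem_nhdsWithin.mono fun x hx ↦
    le_iSup₂_of_le x hx le_rfl)

variable [CompleteSpace H]

theorem MeasureTheory.MemLp.lintegral_enorm_laplace_sq
    (hf : MemLp f 2 (volume.restrict (Set.Ioi 0))) {x : ℝ} (hx : 0 < x) :
    ∫⁻ ω : ℝ, ‖laplace f (x + ω * Complex.I)‖ₑ ^ 2 =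
      ENNReal.ofReal (2 * π) *
        ∫⁻ t : ℝ in Set.Ioi 0, ‖Complex.exp (-(x * t : ℂ)) • f t‖ₑ ^ 2 := by
  rw [← lintegral_two_pi_comp_mul]
  simp_rw [laplace_eq_fourier]
  rw [(hf.indicator_cexp_smul hx).lintegral_enorm_fourier_sq (hf.integrable_indicator_cexp_smul hx),
    ← lintegral_indicator measurableSet_Ioi]
  congr 2 with t
  by_cases ht : t ∈ Set.Ioi (0 : ℝ) <;> simp [ht]

end Laplace

theorem Continuous.integrable_of_lintegral_le {E : Type*} [NormedAddCommGroup E] {g : ℝ → E}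
    (hg : Continuous g) {C : ℝ≥0∞} (hC : C ≠ ⊤) (h : ∫⁻ ω, ‖g ω‖ₑ ≤ C) : Integrable g :=
  ⟨hg.aestronglyMeasurable, h.trans_lt hC.lt_top⟩

section VerticalLine

open Real FourierTransform

variable {H : Type*} [NormedAddCommGroup H] [InnerProductSpace ℂ H] {h : ℂ → H}

theorem DifferentiableOn.continuous_vertical (hd : DifferentiableOn ℂ h {s : ℂ | 0 < s.re}) {x : ℝ}
    (hx : 0 < x) : Continuous fun ω : ℝ ↦ h (x + ω * Complex.I) :=
  hd.continuousOn.comp_continuous (by fun_prop) fun ω ↦ by simpa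

theorem enorm_rectIntegral_le [CompleteSpace H] (hd : DifferentiableOn ℂ h {s : ℂ | 0 < s.re})
    {a b : ℝ} (ha : 0 < a) (hab : a ≤ b) (T : ℝ) :
    ‖(∫ ω in -T..T, h (b + ω * Complex.I)) - ∫ ω in -T..T, h (a + ω * Complex.I)‖ₑ ≤
      (∫⁻ x in Set.Ioc a b, ‖h (x + T * Complex.I)‖ₑ) +
        ∫⁻ x in Set.Ioc a b, ‖h (x + (-T : ℝ) * Complex.I)‖ₑ := by
  have key := Complex.integral_boundary_rect_eq_zero_of_differentiableOn h
    (a + (-T : ℝ) * Complex.I) (b + T * Complex.I) (hd.mono fun z hz ↦ ?_)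
  · simp only [Complex.add_re, Complex.add_im, Complex.mul_re, Complex.mul_im, Complex.ofReal_re,
      Complex.ofReal_im, Complex.I_re, Complex.I_im, mul_zero, mul_one, zero_add, add_zero,
      sub_zero] at key
    have h1 : Complex.I • ((∫ ω in -T..T, h (b + ω * Complex.I)) -
        ∫ ω in -T..T, h (a + ω * Complex.I)) = (∫ x in a..b, h (x + T * Complex.I)) -
          ∫ x in a..b, h (x + (-T : ℝ) * Complex.I) := by
      rw [smul_sub, ← sub_eq_zero, ← key]
      abel
    have h2 (g : ℝ → H) : ‖∫ x in a..b, g x‖ₑ ≤ ∫⁻ x in Set.Ioc a b, ‖g x‖ₑ := by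
      rw [intervalIntegral.integral_of_le hab]
      exact enorm_integral_le_lintegral_enorm _
    calc _ = ‖Complex.I • ((∫ ω in -T..T, h (b + ω * Complex.I)) -
        ∫ ω in -T..T, h (a + ω * Complex.I))‖ₑ := by
          rw [enorm_smul, ← ofReal_norm Complex.I]; simp
      _ ≤ _ := by
        rw [h1]
        exact enorm_sub_le.trans (add_le_add (h2 _) (h2 _))
  · have hz' := hz.1
    simp only [Complex.add_re, Complex.mul_re, Complex.ofReal_re, Complex.ofReal_im, Complex.I_re,
      Complex.I_im, mul_zero, mul_one, sub_zero, add_zero, Set.uIcc_of_le hab,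
      Set.mem_preimage] at hz'
    exact ha.trans_le hz'.1

/-- Shifting the line of integration: if the `L¹` norms of a holomorphic function on the vertical
lines of a strip are bounded, then its integral over these lines is constant. -/
theorem DifferentiableOn.integral_vertical_eq [CompleteSpace H]
    (hd : DifferentiableOn ℂ h {s : ℂ | 0 < s.re}) {a b : ℝ} (ha : 0 < a) (hab : a ≤ b)
    {C : ℝ≥0∞} (hC : C ≠ ⊤)
    (hb : ∀ x ∈ Set.Icc a b, ∫⁻ ω : ℝ, ‖h (x + ω * Complex.I)‖ₑ ≤ C) :
    ∫ ω : ℝ, h (a + ω * Complex.I) = ∫ ω : ℝ, h (b + ω * Complex.I) := by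
  have hia := (hd.continuous_vertical ha).integrable_of_lintegral_le hC (hb a ⟨le_rfl, hab⟩)
  have hib := (hd.continuous_vertical (ha.trans_le hab)).integrable_of_lintegral_le hC
    (hb b ⟨hab, le_rfl⟩)
  set K : ℝ → ℝ≥0∞ := fun T ↦ ∫⁻ x in Set.Ioc a b, ‖h (x + T * Complex.I)‖ₑ with hK
  have hmeas : AEMeasurable (Function.uncurry fun T x : ℝ ↦ ‖h (x + T * Complex.I)‖ₑ)
      (volume.prod (volume.restrict (Set.Ioc a b))) := by
    rw [← Measure.restrict_univ (μ := (volume : Measure ℝ)), Measure.prod_restrict,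
      Measure.restrict_univ]
    refine ContinuousOn.aemeasurable ?_ (MeasurableSet.univ.prod measurableSet_Ioc)
    exact (hd.continuousOn.comp (by fun_prop) fun p hp ↦ by
      simpa using ha.trans hp.2.1 : ContinuousOn (fun p : ℝ × ℝ ↦ h (p.2 + p.1 * Complex.I))
        (Set.univ ×ˢ Set.Ioc a b)).enorm
  have hKint : ∫⁻ T, K T ≠ ⊤ := by
    rw [hK, lintegral_lintegral_swap hmeas]
    refine ne_top_of_le_ne_top (b := ∫⁻ x in Set.Ioc a b, C) ?_ ?_
    · simpa using ENNReal.mul_ne_top hC (by simp)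
    · exact setLIntegral_mono measurable_const fun x hx ↦ hb x (Set.Ioc_subset_Icc_self hx)
  have hKmeas : AEMeasurable K := hmeas.lintegral_prod_right'
  have hsum : ∫⁻ T, (K T + K (-T)) ≠ ⊤ := by
    rw [lintegral_add_left' hKmeas, lintegral_neg_eq_self]
    exact ENNReal.add_ne_top.2 ⟨hKint, hKint⟩
  have hlim := ((intervalIntegral_tendsto_integral hib tendsto_neg_atTop_atBot tendsto_id).sub
    (intervalIntegral_tendsto_integral hia tendsto_neg_atTop_atBot tendsto_id)).enorm
  by_contra hne
  set D := (∫ ω : ℝ, h (b + ω * Complex.I)) - ∫ ω : ℝ, h (a + ω * Complex.I) with hD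
  have hD0 : ‖D‖ₑ ≠ 0 := by simpa [hD, sub_eq_zero] using Ne.symm hne
  obtain ⟨T₀, hT₀⟩ := eventually_atTop.1
    (hlim.eventually_const_lt (ENNReal.half_lt_self hD0 enorm_ne_top))
  refine hsum (top_le_iff.1 ?_)
  calc (⊤ : ℝ≥0∞) = ∫⁻ T in Set.Ici T₀, ‖D‖ₑ / 2 := by simp [ENNReal.mul_top, hD0]
    _ ≤ ∫⁻ T in Set.Ici T₀, (K T + K (-T)) := by
      refine setLIntegral_mono' measurableSet_Ici fun T hT ↦ ?_
      exact (hT₀ T hT).le.trans (enorm_rectIntegral_le hd ha hab T)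
    _ ≤ _ := setLIntegral_le_lintegral _ _

/-- The inverse Fourier transform of a holomorphic function along the vertical line `Re s = x`,
multiplied by `exp (x t)`, i.e. its Bromwich integral `(2πi)⁻¹ ∫ exp (s t) h s ds`. -/
noncomputable def bromwich (h : ℂ → H) (x t : ℝ) : H :=
  Complex.exp (x * t) • 𝓕⁻ (fun ξ : ℝ ↦ h (x + (2 * π * ξ : ℝ) * Complex.I)) t

theorem two_pi_smul_bromwich (h : ℂ → H) (x t : ℝ) :
    (2 * π) • bromwich h x t =
      ∫ ω : ℝ, Complex.exp ((x + ω * Complex.I) * t) • h (x + ω * Complex.I) := by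
  have hscale := Measure.integral_comp_mul_left
    (fun ω : ℝ ↦ Complex.exp ((x + ω * Complex.I) * t) • h (x + ω * Complex.I)) (2 * π)
  rw [abs_of_pos (inv_pos.2 two_pi_pos), eq_inv_smul_iff₀ two_pi_pos.ne'] at hscale
  rw [bromwich, Real.fourierInv_eq', ← integral_smul, ← hscale]
  congr 2 with ξ
  rw [smul_smul, ← Complex.exp_add]
  congr 2
  simp only [RCLike.inner_apply, conj_trivial]
  push_cast; ring

variable [CompleteSpace H]

theorem DifferentiableOn.bromwich_eq (hd : DifferentiableOn ℂ h {s : ℂ | 0 < s.re}) {C : ℝ≥0∞}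
    (hC : C ≠ ⊤) (hb : ∀ x : ℝ, 0 < x → ∫⁻ ω : ℝ, ‖h (x + ω * Complex.I)‖ₑ ≤ C) {x y : ℝ}
    (hx : 0 < x) (hy : 0 < y) : bromwich h x = bromwich h y := by
  wlog hxy : x ≤ y generalizing x y
  · exact (this hy hx (le_of_not_ge hxy)).symm
  ext t
  refine smul_right_injective H two_pi_pos.ne' ?_
  simp only [two_pi_smul_bromwich]
  refine DifferentiableOn.integral_vertical_eq (h := fun s ↦ Complex.exp (s * t) • h s)
    (DifferentiableOn.smul (by fun_prop) hd) hx hxy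
    (C := ENNReal.ofReal (Real.exp (y * |t|)) * C) (ENNReal.mul_ne_top (by simp) hC) fun u hu ↦ ?_
  grw [← hb u (hx.trans_le hu.1)]
  rw [← lintegral_const_mul' _ _ (by simp)]
  refine lintegral_mono fun ω ↦ ?_
  rw [enorm_smul]
  gcongr
  rw [← ofReal_norm, Complex.norm_exp]
  gcongr
  simp only [Complex.mul_re, Complex.add_re, Complex.ofReal_re, Complex.I_re, Complex.I_im,
    Complex.ofReal_im, mul_zero, sub_zero]
  nlinarith [le_abs_self t, abs_nonneg t, hu.1, hu.2]

end VerticalLine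

section Inversion

open Real FourierTransform Topology

variable {H : Type*} [NormedAddCommGroup H] [InnerProductSpace ℂ H] {h F : ℂ → H}

theorem lintegral_vertical_two_pi_le {G : ℂ → ℝ≥0∞} {x : ℝ} {C : ℝ≥0∞}
    (hb : ∫⁻ ω : ℝ, G (x + ω * Complex.I) ≤ C) :
    ∫⁻ ξ : ℝ, G (x + (2 * π * ξ : ℝ) * Complex.I) ≤ C := by
  refine le_trans ?_ hb
  rw [← lintegral_two_pi_comp_mul fun ω : ℝ ↦ G (x + ω * Complex.I)]
  exact le_mul_of_one_le_left' (ENNReal.one_le_ofReal.2 (by linarith [pi_gt_three]))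

theorem DifferentiableOn.continuous_vertical_two_pi
    (hd : DifferentiableOn ℂ h {s : ℂ | 0 < s.re}) {x : ℝ} (hx : 0 < x) :
    Continuous fun ξ : ℝ ↦ h (x + (2 * π * ξ : ℝ) * Complex.I) :=
  (hd.continuous_vertical hx).comp (by fun_prop : Continuous fun ξ : ℝ ↦ 2 * π * ξ)

theorem DifferentiableOn.memLp_vertical (hd : DifferentiableOn ℂ h {s : ℂ | 0 < s.re}) {x : ℝ}
    (hx : 0 < x) {C : ℝ≥0∞} (hC : C ≠ ⊤) (hb : ∫⁻ ω : ℝ, ‖h (x + ω * Complex.I)‖ₑ ^ 2 ≤ C) :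
    MemLp (fun ξ : ℝ ↦ h (x + (2 * π * ξ : ℝ) * Complex.I)) 2 :=
  memLp_two_iff_lintegral.2 ⟨(hd.continuous_vertical_two_pi hx).aestronglyMeasurable,
    (lintegral_vertical_two_pi_le (G := fun s ↦ ‖h s‖ₑ ^ 2) hb).trans_lt hC.lt_top⟩

theorem exp_neg_smul_bromwich (h : ℂ → H) (x t : ℝ) :
    Complex.exp (-(x * t)) • bromwich h x t =
      𝓕⁻ (fun ξ : ℝ ↦ h (x + (2 * π * ξ : ℝ) * Complex.I)) t := by
  rw [bromwich, smul_smul, ← Complex.exp_add, neg_add_cancel, Complex.exp_zero, one_smul]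

theorem enorm_exp_neg_smul_bromwich_le {x : ℝ} {C : ℝ≥0∞}
    (hb : ∫⁻ ω : ℝ, ‖h (x + ω * Complex.I)‖ₑ ≤ C) (t : ℝ) :
    ‖Complex.exp (-(x * t)) • bromwich h x t‖ₑ ≤ C := by
  rw [exp_neg_smul_bromwich, Real.fourierInv_eq]
  refine (enorm_integral_le_lintegral_enorm _).trans ?_
  simpa [← ofReal_norm, Circle.norm_smul] using
    lintegral_vertical_two_pi_le (G := fun s ↦ ‖h s‖ₑ) hb

/-- A rational factor that makes a function in the Hardy space `H²` integrable on vertical lines. -/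
noncomputable def damping (ε : ℝ) (s : ℂ) : ℂ := (1 + ε * s)⁻¹

theorem one_le_normSq_one_add_mul {ε : ℝ} (hε : 0 ≤ ε) {s : ℂ} (hs : 0 < s.re) :
    1 + (ε * s.im) ^ 2 ≤ ‖1 + ε * s‖ ^ 2 := by
  rw [Complex.sq_norm, Complex.normSq_apply]
  simp
  nlinarith [mul_nonneg hε hs.le]

theorem norm_damping_sq_le {ε : ℝ} (hε : 0 ≤ ε) {s : ℂ} (hs : 0 < s.re) :
    ‖damping ε s‖ ^ 2 ≤ (1 + (ε * s.im) ^ 2)⁻¹ := by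
  rw [damping, norm_inv, inv_pow]
  exact inv_anti₀ (by positivity) (one_le_normSq_one_add_mul hε hs)

theorem norm_damping_le_one {ε : ℝ} (hε : 0 ≤ ε) {s : ℂ} (hs : 0 < s.re) : ‖damping ε s‖ ≤ 1 := by
  refine (sq_le_one_iff₀ (norm_nonneg _)).1 ((norm_damping_sq_le hε hs).trans ?_)
  exact inv_le_one_of_one_le₀ (by nlinarith [sq_nonneg (ε * s.im)])

theorem one_add_mul_ne_zero {ε : ℝ} (hε : 0 ≤ ε) {s : ℂ} (hs : 0 < s.re) : (1 + ε * s : ℂ) ≠ 0 := by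
  intro h0
  have := one_le_normSq_one_add_mul hε hs
  rw [h0] at this
  norm_num at this
  nlinarith [sq_nonneg (ε * s.im)]

theorem differentiableOn_damping {ε : ℝ} (hε : 0 ≤ ε) :
    DifferentiableOn ℂ (damping ε) {s : ℂ | 0 < s.re} :=
  DifferentiableOn.inv (by fun_prop) fun _ hs ↦ one_add_mul_ne_zero hε hs

theorem tendsto_damping (s : ℂ) : Tendsto (fun ε ↦ damping ε s) (𝓝 0) (𝓝 1) := by
  have : Tendsto (fun ε : ℝ ↦ (1 + ε * s : ℂ)) (𝓝 0) (𝓝 1) := by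
    have hc : Continuous fun ε : ℝ ↦ (1 + ε * s : ℂ) := by fun_prop
    simpa using hc.tendsto 0
  simpa [damping] using this.inv₀ one_ne_zero

theorem norm_damping_smul_sub_le {ε : ℝ} (hε : 0 ≤ ε) {s : ℂ} (hs : 0 < s.re) (v : H) :
    ‖damping ε s • v - v‖ ≤ 2 * ‖v‖ := by
  refine (norm_sub_le _ _).trans ?_
  rw [norm_smul, two_mul]
  gcongr
  exact mul_le_of_le_one_left (norm_nonneg _) (norm_damping_le_one hε hs)

theorem lintegral_inv_one_add_sq_ne_top {ε : ℝ} (hε : ε ≠ 0) :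
    ∫⁻ ω : ℝ, ENNReal.ofReal (1 + (ε * ω) ^ 2)⁻¹ ≠ ⊤ := by
  have h : Integrable fun ω : ℝ ↦ (1 + (ε * ω) ^ 2)⁻¹ :=
    integrable_inv_one_add_sq.comp_mul_left' hε
  exact ((hasFiniteIntegral_iff_ofReal (.of_forall fun _ ↦ by positivity)).1 h.2).ne

theorem lintegral_damping_smul_le {ε x : ℝ} (hε : 0 ≤ ε) (hx : 0 < x) :
    ∫⁻ ω : ℝ, ‖damping ε (x + ω * Complex.I) • F (x + ω * Complex.I)‖ₑ ≤
      (∫⁻ ω : ℝ, ENNReal.ofReal (1 + (ε * ω) ^ 2)⁻¹) +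
        ∫⁻ ω : ℝ, ‖F (x + ω * Complex.I)‖ₑ ^ 2 := by
  rw [← lintegral_add_left (by fun_prop)]
  refine lintegral_mono fun ω ↦ ?_
  have hd := norm_damping_sq_le hε (s := x + ω * Complex.I) (by simpa)
  simp only [← ofReal_norm, ← ENNReal.ofReal_pow (norm_nonneg _)]
  rw [← ENNReal.ofReal_add (by positivity) (by positivity)]
  refine ENNReal.ofReal_le_ofReal ?_
  simp only [Complex.add_im, Complex.ofReal_im, Complex.mul_im, Complex.I_im, Complex.ofReal_re,
    Complex.I_re, mul_one, mul_zero, add_zero, zero_add] at hd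
  rw [norm_smul]
  nlinarith [sq_nonneg (‖damping ε (x + ω * Complex.I)‖ - ‖F (x + ω * Complex.I)‖)]

theorem lintegral_damping_smul_sq_le {ε x : ℝ} (hε : 0 ≤ ε) (hx : 0 < x) :
    ∫⁻ ω : ℝ, ‖damping ε (x + ω * Complex.I) • F (x + ω * Complex.I)‖ₑ ^ 2 ≤
      ∫⁻ ω : ℝ, ‖F (x + ω * Complex.I)‖ₑ ^ 2 := by
  refine lintegral_mono fun ω ↦ ?_
  gcongr ?_ ^ 2
  rw [enorm_le_iff_norm_le, norm_smul]
  exact mul_le_of_le_one_left (norm_nonneg _) (norm_damping_le_one hε (by simpa))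

variable [CompleteSpace H]

theorem DifferentiableOn.bromwich_eq_zero_of_neg (hd : DifferentiableOn ℂ h {s : ℂ | 0 < s.re})
    {C : ℝ≥0∞} (hC : C ≠ ⊤) (hb : ∀ x : ℝ, 0 < x → ∫⁻ ω : ℝ, ‖h (x + ω * Complex.I)‖ₑ ≤ C)
    {x t : ℝ} (hx : 0 < x) (ht : t < 0) : bromwich h x t = 0 := by
  have hle (y : ℝ) (hy : 0 < y) : ‖bromwich h x t‖ ≤ Real.exp (y * t) * C.toReal := by
    have h1 := ENNReal.toReal_mono hC (enorm_exp_neg_smul_bromwich_le (hb y hy) t)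
    rw [hd.bromwich_eq hC hb hy hx, toReal_enorm, norm_cexp_neg_mul_smul, Complex.ofReal_re] at h1
    calc ‖bromwich h x t‖ = Real.exp (y * t) * (Real.exp (-y * t) * ‖bromwich h x t‖) := by
          rw [← mul_assoc, ← Real.exp_add]; simp
      _ ≤ _ := by gcongr
  have hlim : Tendsto (fun y ↦ Real.exp (y * t) * C.toReal) atTop (𝓝 (0 * C.toReal)) :=
    (tendsto_exp_atBot.comp (tendsto_id.atTop_mul_const_of_neg ht)).mul_const _
  rw [zero_mul] at hlim
  exact norm_le_zero_iff.1 (ge_of_tendsto hlim ((eventually_gt_atTop 0).mono hle))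

theorem DifferentiableOn.lintegral_exp_neg_smul_bromwich_le
    (hd : DifferentiableOn ℂ h {s : ℂ | 0 < s.re}) {C C' : ℝ≥0∞} (hC : C ≠ ⊤) (hC' : C' ≠ ⊤)
    (hb : ∀ x : ℝ, 0 < x → ∫⁻ ω : ℝ, ‖h (x + ω * Complex.I)‖ₑ ≤ C)
    (hb' : ∀ x : ℝ, 0 < x → ∫⁻ ω : ℝ, ‖h (x + ω * Complex.I)‖ₑ ^ 2 ≤ C') {x y : ℝ} (hx : 0 < x)
    (hy : 0 < y) : ∫⁻ t : ℝ, ‖Complex.exp (-(x * t : ℂ)) • bromwich h y t‖ₑ ^ 2 ≤ C' := by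
  simp_rw [hd.bromwich_eq hC hb hy hx, exp_neg_smul_bromwich]
  rw [(hd.memLp_vertical hx hC' (hb' x hx)).lintegral_enorm_fourierInv_sq]
  · exact lintegral_vertical_two_pi_le (G := fun s ↦ ‖h s‖ₑ ^ 2) (hb' x hx)
  · exact (hd.continuous_vertical_two_pi hx).integrable_of_lintegral_le hC
      (lintegral_vertical_two_pi_le (G := fun s ↦ ‖h s‖ₑ) (hb x hx))

end Inversion

theorem tendsto_toLp_two_of_dominated {α E : Type*} [MeasurableSpace α] {μ : Measure α}
    [NormedAddCommGroup E] {g : ℕ → α → E} {g₀ : α → E} (hg : ∀ n, MemLp (g n) 2 μ)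
    (hg₀ : MemLp g₀ 2 μ) (hle : ∀ n x, ‖g n x - g₀ x‖ ≤ 2 * ‖g₀ x‖)
    (hlim : ∀ x, Tendsto (fun n ↦ g n x) atTop (nhds (g₀ x))) :
    Tendsto (fun n ↦ (hg n).toLp (g n)) atTop (nhds (hg₀.toLp g₀)) := by
  rw [Lp.tendsto_Lp_iff_tendsto_eLpNorm'']
  simp_rw [eLpNorm_eq_lintegral_rpow_enorm_toReal two_ne_zero ENNReal.ofNat_ne_top]
  have h0 : (0 : ℝ≥0∞) = (∫⁻ _, 0 ∂μ) ^ (1 / (2 : ℝ≥0∞).toReal) := by simp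
  rw [h0]
  refine (ENNReal.continuous_rpow_const.tendsto _).comp ?_
  simp only [ENNReal.toReal_ofNat, ENNReal.rpow_ofNat, Pi.sub_apply]
  refine tendsto_lintegral_of_dominated_convergence' (fun x ↦ ‖(2 : ℝ) * ‖g₀ x‖‖ₑ ^ 2)
    (fun n ↦ (((hg n).sub hg₀).1.enorm.pow_const 2)) (fun n ↦ .of_forall fun x ↦ ?_)
    (memLp_two_iff_lintegral.1 (hg₀.norm.const_mul 2)).2.ne (.of_forall fun x ↦ ?_)
  · exact pow_le_pow_left' (enorm_le_iff_norm_le.2 ((hle n x).trans (le_abs_self _))) 2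
  · have h1 : Tendsto (fun n ↦ ‖g n x - g₀ x‖ₑ ^ 2) atTop (nhds (‖g₀ x - g₀ x‖ₑ ^ 2)) :=
      (ENNReal.continuous_pow 2).tendsto _ |>.comp ((hlim x).sub_const _).enorm
    simpa using h1

section PaleyWiener

open Real FourierTransform Topology

variable {H : Type*} [NormedAddCommGroup H] [InnerProductSpace ℂ H] [CompleteSpace H] {F : ℂ → H}

theorem exists_seq_tendsto_ae_fourierInv {g : ℕ → ℝ → H} {g₀ : ℝ → H}
    (hg : ∀ n, MemLp (g n) 2) (hg' : ∀ n, Integrable (g n)) (hg₀ : MemLp g₀ 2)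
    (hlim : Tendsto (fun n ↦ (hg n).toLp (g n)) atTop (𝓝 (hg₀.toLp g₀))) :
    ∃ ns : ℕ → ℕ, ∀ᵐ t, Tendsto (fun k ↦ 𝓕⁻ (g (ns k)) t) atTop
      (𝓝 ((𝓕⁻ (hg₀.toLp g₀) : Lp H 2 (volume : Measure ℝ)) t)) := by
  have h1 := ((ContinuousFourierInv.continuous_fourierInv
    (E := Lp H 2 (volume : Measure ℝ))).tendsto _).comp hlim
  obtain ⟨ns, -, hns⟩ := (tendstoInMeasure_of_tendsto_Lp h1).exists_seq_tendsto_ae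
  refine ⟨ns, ?_⟩
  filter_upwards [hns, ae_all_iff.2 fun n ↦ (hg n).coeFn_fourierInv_toLp (hg' n)] with t h2 h3
  exact h2.congr fun k ↦ h3 (ns k)

theorem DifferentiableOn.eqOn_re_pos {G : ℂ → H} (hF : DifferentiableOn ℂ F {s : ℂ | 0 < s.re})
    (hG : DifferentiableOn ℂ G {s : ℂ | 0 < s.re}) {x : ℝ} (hx : 0 < x)
    (h : ∀ ξ : ℝ, F (x + (2 * π * ξ : ℝ) * Complex.I) = G (x + (2 * π * ξ : ℝ) * Complex.I)) :
    Set.EqOn F G {s : ℂ | 0 < s.re} := by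
  refine (hF.analyticOnNhd isOpen_re_pos).eqOn_of_preconnected_of_frequently_eq
    (hG.analyticOnNhd isOpen_re_pos) (convex_halfSpace_re_gt 0).isPreconnected (z₀ := (x : ℂ))
    (by simpa) ?_
  have hc : Continuous fun ξ : ℝ ↦ (x + (2 * π * ξ : ℝ) * Complex.I : ℂ) := by fun_prop
  have ht : Tendsto (fun ξ : ℝ ↦ (x + (2 * π * ξ : ℝ) * Complex.I : ℂ)) (𝓝[≠] 0) (𝓝[≠] x) := by
    refine tendsto_nhdsWithin_iff.2 ⟨(hc.tendsto' 0 x (by simp)).mono_left nhdsWithin_le_nhds,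
      eventually_mem_nhdsWithin.mono fun ξ (hξ : ξ ≠ 0) ↦ ?_⟩
    simp [hξ, pi_ne_zero]
  exact ht.frequently (Eventually.of_forall h).frequently

/-- The surjectivity part of the Paley–Wiener theorem. -/
theorem DifferentiableOn.exists_eq_laplace (hd : DifferentiableOn ℂ F {s : ℂ | 0 < s.re})
    {C : ℝ≥0∞} (hC : C ≠ ⊤) (hb : ∀ x : ℝ, 0 < x → ∫⁻ ω : ℝ, ‖F (x + ω * Complex.I)‖ₑ ^ 2 ≤ C) :
    ∃ f : ℝ → H, MemLp f 2 (volume.restrict (Set.Ioi 0)) ∧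
      Set.EqOn F (laplace f) {s : ℂ | 0 < s.re} := by
  let ε (n : ℕ) : ℝ := 1 / (n + 1)
  have hε (n : ℕ) : 0 < ε n := Nat.one_div_pos_of_nat
  have hε0 : Tendsto ε atTop (𝓝 0) := tendsto_one_div_add_atTop_nhds_zero_nat
  let G (n : ℕ) (s : ℂ) : H := damping (ε n) s • F s
  have hGd (n : ℕ) : DifferentiableOn ℂ (G n) {s : ℂ | 0 < s.re} :=
    (differentiableOn_damping (hε n).le).smul hd
  have hG1 (n : ℕ) (x : ℝ) (hx : 0 < x) := (lintegral_damping_smul_le (hε n).le hx).trans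
    (add_le_add_right (hb x hx) _)
  have hGC (n : ℕ) : (∫⁻ ω : ℝ, ENNReal.ofReal (1 + (ε n * ω) ^ 2)⁻¹) + C ≠ ⊤ :=
    ENNReal.add_ne_top.2 ⟨lintegral_inv_one_add_sq_ne_top (hε n).ne', hC⟩
  have hG2 (n : ℕ) (x : ℝ) (hx : 0 < x) : ∫⁻ ω : ℝ, ‖G n (x + ω * Complex.I)‖ₑ ^ 2 ≤ C :=
    (lintegral_damping_smul_sq_le (hε n).le hx).trans (hb x hx)
  let line (ξ : ℝ) : ℂ := ((1 : ℝ) : ℂ) + (2 * π * ξ : ℝ) * Complex.I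
  have hline (ξ : ℝ) : 0 < (line ξ).re := by simp [line]
  have hF2 : MemLp (fun ξ ↦ F (line ξ)) 2 := hd.memLp_vertical one_pos hC (hb 1 one_pos)
  have hGn2 (n : ℕ) : MemLp (fun ξ ↦ G n (line ξ)) 2 :=
    (hGd n).memLp_vertical one_pos hC (hG2 n 1 one_pos)
  have hGn1 (n : ℕ) : Integrable (fun ξ ↦ G n (line ξ)) :=
    ((hGd n).continuous_vertical_two_pi one_pos).integrable_of_lintegral_le (hGC n)
      (lintegral_vertical_two_pi_le (G := fun s ↦ ‖G n s‖ₑ) (hG1 n 1 one_pos))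
  obtain ⟨ns, hns⟩ := exists_seq_tendsto_ae_fourierInv hGn2 hGn1 hF2
    (tendsto_toLp_two_of_dominated hGn2 hF2
      (fun n ξ ↦ norm_damping_smul_sub_le (hε n).le (hline ξ) _) fun ξ ↦ by
        simpa using (((tendsto_damping (line ξ)).comp hε0).smul_const (F (line ξ))))
  set U : Lp H 2 (volume : Measure ℝ) := 𝓕⁻ (hF2.toLp _) with hU
  let f (t : ℝ) : H := Complex.exp ((1 : ℝ) * t) • U t
  have hfm : AEStronglyMeasurable f :=
    (by fun_prop : Continuous fun t : ℝ ↦ Complex.exp ((1 : ℝ) * t)).aestronglyMeasurable.smul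
      (Lp.aestronglyMeasurable U)
  have hf (t : ℝ) : Complex.exp (-((1 : ℝ) * t)) • f t = U t := by
    simp only [f]
    rw [smul_smul, ← Complex.exp_add, neg_add_cancel, Complex.exp_zero, one_smul]
  have hlim : ∀ᵐ t, Tendsto (fun k ↦ bromwich (G (ns k)) 1 t) atTop (𝓝 (f t)) :=
    hns.mono fun t ht ↦ ht.const_smul _
  have hneg : ∀ᵐ t, t < 0 → f t = 0 := hlim.mono fun t ht ht0 ↦ by
    refine tendsto_nhds_unique ht (tendsto_const_nhds.congr fun k ↦ ?_)
    exact ((hGd _).bromwich_eq_zero_of_neg (hGC _) (hG1 _) one_pos ht0).symm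
  have hfL : ∫⁻ t, ‖f t‖ₑ ^ 2 ≤ C := by
    let u (k : ℕ) (t : ℝ) : ℝ≥0∞ := ‖Complex.exp (-(ε k * t)) • bromwich (G (ns k)) 1 t‖ₑ ^ 2
    have hu (k : ℕ) : ∫⁻ t, u k t ≤ C := (hGd _).lintegral_exp_neg_smul_bromwich_le (hGC _) hC
      (hG1 _) (hG2 _) (hε k) one_pos
    have hum (k : ℕ) : AEMeasurable (u k) := by
      have hcont : Continuous fun t : ℝ ↦ Complex.exp (-(ε k * t)) • bromwich (G (ns k)) 1 t := by
        have := (hGn1 (ns k)).continuous_fourierInv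
        unfold bromwich
        fun_prop
      exact (hcont.enorm.measurable.pow_const 2).aemeasurable
    have hul : ∀ᵐ t, Tendsto (fun k ↦ u k t) atTop (𝓝 (‖f t‖ₑ ^ 2)) := hlim.mono fun t ht ↦ by
      have h1 : Continuous fun e : ℝ ↦ Complex.exp (-(e * t)) := by fun_prop
      have h2 := ((h1.tendsto 0).comp hε0).smul ht
      rw [Complex.ofReal_zero, zero_mul, neg_zero, Complex.exp_zero, one_smul] at h2
      exact ((ENNReal.continuous_pow 2).tendsto _).comp h2.enorm
    calc ∫⁻ t, ‖f t‖ₑ ^ 2 = ∫⁻ t, liminf (fun k ↦ u k t) atTop :=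
          lintegral_congr_ae (hul.mono fun t ht ↦ ht.liminf_eq.symm)
      _ ≤ liminf (fun k ↦ ∫⁻ t, u k t) atTop := lintegral_liminf_le' hum
      _ ≤ C := liminf_le_of_le (by isBoundedDefault) fun b hb' ↦
          (hb'.exists.choose_spec).trans (hu _)
  have hfMem : MemLp f 2 (volume.restrict (Set.Ioi 0)) :=
    (memLp_two_iff_lintegral.2 ⟨hfm, hfL.trans_lt hC.lt_top⟩).restrict _
  refine ⟨f, hfMem, hd.eqOn_re_pos hfMem.differentiableOn_laplace one_pos fun ξ ↦ ?_⟩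
  have hV : (hfMem.indicator_cexp_smul one_pos).toLp _ = U := by
    refine Lp.ext ((MemLp.coeFn_toLp _).trans ?_)
    filter_upwards [hneg, (ae_iff.2 (by simp) : ∀ᵐ t : ℝ, t ≠ 0)] with t ht ht0
    rcases ht0.lt_or_gt with h0 | h0
    · rw [Set.indicator_of_notMem (by simpa using h0.le), ← hf, ht h0, smul_zero]
    · rw [Set.indicator_of_mem (by simpa using h0), hf]
  have h3 := (hfMem.indicator_cexp_smul one_pos).coeFn_fourier_toLp
    (hfMem.integrable_indicator_cexp_smul one_pos)
  rw [hV, hU, FourierTransform.fourier_fourierInv_eq] at h3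
  rw [laplace_eq_fourier]
  refine congrFun (((hd.continuous_vertical_two_pi one_pos).ae_eq_iff_eq (μ := volume)
    (hfMem.integrable_indicator_cexp_smul one_pos).continuous_fourier).1 ?_) ξ
  exact hF2.coeFn_toLp.symm.trans h3

end PaleyWiener

/-- Paley–Wiener theorem: the Laplace transform `f ↦ (s ↦ ∫₀^∞ e^{-st} f(t) dt)` maps
`L²([0,∞); H)` into the Hardy space `H²(ℂ₊; H)`, is isometric with the normalization
`‖f̂‖² = sup_{x>0} (1/2π) ∫ ‖f̂(x+iω)‖² dω = ‖f‖²`, and is onto `H²(ℂ₊; H)`. -/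
theorem paley_wiener_laplace_isometric_iso
    {H : Type*} [NormedAddCommGroup H] [InnerProductSpace ℂ H] [CompleteSpace H]
    [SecondCountableTopology H] :
    (∀ f : ℝ → H, AEStronglyMeasurable f (volume.restrict (Set.Ioi (0 : ℝ))) →
      (∫⁻ t in Set.Ioi (0 : ℝ), (‖f t‖₊ : ℝ≥0∞) ^ 2) < ⊤ →
      DifferentiableOn ℂ
        (fun s : ℂ => ∫ t in Set.Ioi (0 : ℝ), Complex.exp (-(s * (t : ℂ))) • f t)
        {s : ℂ | 0 < s.re} ∧
      (⨆ x ∈ Set.Ioi (0 : ℝ), (ENNReal.ofReal (2 * Real.pi))⁻¹ *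
          ∫⁻ ω : ℝ, (‖∫ t in Set.Ioi (0 : ℝ),
            Complex.exp (-(((x : ℂ) + (ω : ℂ) * Complex.I) * (t : ℂ))) • f t‖₊ : ℝ≥0∞) ^ 2)
        = ∫⁻ t in Set.Ioi (0 : ℝ), (‖f t‖₊ : ℝ≥0∞) ^ 2) ∧
    (∀ F : ℂ → H, DifferentiableOn ℂ F {s : ℂ | 0 < s.re} →
      (⨆ x ∈ Set.Ioi (0 : ℝ),
        ∫⁻ ω : ℝ, (‖F ((x : ℂ) + (ω : ℂ) * Complex.I)‖₊ : ℝ≥0∞) ^ 2) < ⊤ →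
      ∃ f : ℝ → H, AEStronglyMeasurable f (volume.restrict (Set.Ioi (0 : ℝ))) ∧
        (∫⁻ t in Set.Ioi (0 : ℝ), (‖f t‖₊ : ℝ≥0∞) ^ 2) < ⊤ ∧
        ∀ s : ℂ, 0 < s.re →
          F s = ∫ t in Set.Ioi (0 : ℝ), Complex.exp (-(s * (t : ℂ))) • f t) := by
  refine ⟨fun f hfm hf ↦ ?_, fun F hF hb ↦ ?_⟩
  · have hf2 : MemLp f 2 (volume.restrict (Set.Ioi 0)) := memLp_two_iff_lintegral.2 ⟨hfm, hf⟩
    refine ⟨hf2.differentiableOn_laplace, Eq.trans ?_ hf2.iSup_lintegral_cexp_smul⟩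
    refine iSup_congr fun x ↦ iSup_congr fun hx ↦ ?_
    have h := hf2.lintegral_enorm_laplace_sq hx
    refine (congrArg ((ENNReal.ofReal (2 * Real.pi))⁻¹ * ·) h).trans ?_
    exact ENNReal.inv_mul_cancel_left (ENNReal.ofReal_pos.2 Real.two_pi_pos).ne'
      ENNReal.ofReal_ne_top
  · obtain ⟨f, hf, hFf⟩ := hF.exists_eq_laplace hb.ne
      fun x hx ↦ le_iSup₂_of_le x (Set.mem_Ioi.2 hx) le_rfl
    exact ⟨f, hf.1, (memLp_two_iff_lintegral.1 hf).2, fun s hs ↦ hFf hs⟩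
end

section
/- Let G_k : ℝ → ℂ^{p_k × m_k} (k = 1,…,N) be bounded continuous matrix functions, E a non-negative N×N matrix, and set Θ = [sup_{ω∈ℝ} ρ(diag(‖G_k(iω)‖²) E^{∘2})]^{1/2}. For any block operator Δ = (Δ_{kl}) with Δ_{kl} ∈ ℂ^{m_k × p_l} and ‖Δ‖ = max_k ‖[Δ_{k1},…,Δ_{kN}]‖ < 1/Θ, every ω ∈ ℝ and every eigenvalue λ of the matrix (e_{kl} G_k(iω) Δ_{kl})_{k,l} satisfies |λ| ≤ ‖Δ‖ Θ < 1; consequently 1 is not in the closure of ⋃_{ω∈ℝ} σ((e_{kl} G_k(iω) Δ_{kl})_{k,l}). -/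
open scoped ENNReal

section NonnegMatrix

open scoped Matrix

attribute [local instance] Matrix.linftyOpNormedRing Matrix.linftyOpNormedAlgebra

variable {n : Type*} [Fintype n] [DecidableEq n]

/-- Iterating the subinvariance inequality `c v ≤ A v` of an entrywise non-negative matrix. -/
lemma pow_mul_le_pow_mulVec {A : Matrix n n ℝ} (hA : ∀ k l, 0 ≤ A k l) {v : n → ℝ} {c : ℝ}
    (hc : 0 ≤ c) (h : ∀ k, c * v k ≤ (A *ᵥ v) k) (j : ℕ) (k : n) :
    c ^ j * v k ≤ ((A ^ j) *ᵥ v) k := by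
  induction j generalizing k with
  | zero => simp
  | succ j ih =>
    calc c ^ (j + 1) * v k = c ^ j * (c * v k) := by ring
      _ ≤ c ^ j * (A *ᵥ v) k := by gcongr; exact h k
      _ = ∑ l, A k l * (c ^ j * v l) := by
        simp only [Matrix.mulVec, dotProduct, Finset.mul_sum]
        exact Finset.sum_congr rfl fun l _ => by ring
      _ ≤ ∑ l, A k l * ((A ^ j) *ᵥ v) l :=
        Finset.sum_le_sum fun l _ => mul_le_mul_of_nonneg_left (ih l) (hA k l)
      _ = ((A ^ (j + 1)) *ᵥ v) k := by
        rw [pow_succ', ← Matrix.mulVec_mulVec]; rfl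

/-- The Collatz–Wielandt lower bound: if `A` and `v ≠ 0` are entrywise non-negative and
`c v ≤ A v`, then `c` is at most the spectral radius of `A`. -/
lemma ofReal_le_spectralRadius_of_mul_le_mulVec {A : Matrix n n ℝ} (hA : ∀ k l, 0 ≤ A k l)
    {v : n → ℝ} (hv : ∀ k, 0 ≤ v k) (hv0 : v ≠ 0) {c : ℝ} (hc : 0 ≤ c)
    (h : ∀ k, c * v k ≤ (A *ᵥ v) k) :
    ENNReal.ofReal c ≤ spectralRadius ℂ (A.map Complex.ofReal) := by
  have : CompleteSpace (Matrix n n ℂ) := FiniteDimensional.complete ℂ _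
  set B : Matrix n n ℂ := A.map Complex.ofReal with hB
  set w : n → ℂ := fun k => (v k : ℂ) with hw
  have hpow : ∀ j : ℕ, c ^ j ≤ ‖B ^ j‖ := fun j => by
    have hBj : B ^ j = (A ^ j).map Complex.ofReal :=
      (Matrix.map_pow (f := Complex.ofRealHom) A j).symm
    have hw0 : 0 < ‖w‖ := norm_pos_iff.2 fun h0 => hv0 <| funext fun k => by
      simpa [hw] using congrFun h0 k
    refine le_of_mul_le_mul_right ?_ hw0
    refine le_trans ?_ (Matrix.linfty_opNorm_mulVec (B ^ j) w)
    have hmv : (B ^ j) *ᵥ w = fun k => ((((A ^ j) *ᵥ v) k : ℝ) : ℂ) := by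
      funext k
      simp [hBj, hw, Matrix.mulVec, dotProduct]
    calc c ^ j * ‖w‖ = ‖(c ^ j) • w‖ := by
          rw [norm_smul, Real.norm_of_nonneg (pow_nonneg hc j)]
      _ ≤ ‖(B ^ j) *ᵥ w‖ := by
        refine (pi_norm_le_iff_of_nonneg (norm_nonneg _)).2 fun k => ?_
        refine le_trans ?_ (norm_le_pi_norm _ k)
        rw [hmv, Pi.smul_apply, norm_smul, Real.norm_of_nonneg (pow_nonneg hc j)]
        simp only [hw, Complex.norm_real, Real.norm_of_nonneg (hv k)]
        exact (pow_mul_le_pow_mulVec hA hc h j k).trans (le_abs_self _)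
  refine ge_of_tendsto (spectrum.pow_norm_pow_one_div_tendsto_nhds_spectralRadius B) ?_
  filter_upwards [Filter.eventually_gt_atTop 0] with j hj
  refine ENNReal.ofReal_le_ofReal ?_
  calc c = (c ^ j) ^ (1 / (j : ℝ)) := by
        rw [one_div, Real.pow_rpow_inv_natCast hc hj.ne']
    _ ≤ ‖B ^ j‖ ^ (1 / (j : ℝ)) :=
      Real.rpow_le_rpow (pow_nonneg hc j) (hpow j) (by positivity)

end NonnegMatrix

/-- Componentwise estimate for an eigenvector of the block matrix `(e_{kl} G_k Δ_{kl})`. -/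
lemma norm_sq_mul_le_of_block_eigenvector {ι : Type*} [Fintype ι] {X Y : ι → Type*}
    [∀ k, NormedAddCommGroup (X k)] [∀ k, NormedSpace ℂ (X k)]
    [∀ k, NormedAddCommGroup (Y k)] [∀ k, NormedSpace ℂ (Y k)]
    (G : ∀ k, X k →L[ℂ] Y k) (e : ι → ι → ℝ) (Δ : ∀ k l, Y l →L[ℂ] X k)
    (Δrow : ∀ k, PiLp 2 Y →L[ℂ] X k) (hrow : ∀ k (y : PiLp 2 Y), Δrow k y = ∑ l, Δ k l (y l))
    {r : ℝ} (hr : ∀ k, ‖Δrow k‖ ≤ r) {μ : ℂ} {y : PiLp 2 Y}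
    (h : ∀ k, μ • y k = ∑ l, (e k l : ℂ) • G k (Δ k l (y l))) (k : ι) :
    ‖μ‖ ^ 2 * ‖y k‖ ^ 2 ≤ r ^ 2 * ∑ l, (‖G k‖ ^ 2 * e k l ^ 2) * ‖y l‖ ^ 2 := by
  set z : PiLp 2 Y := WithLp.toLp 2 fun l => (e k l : ℂ) • y l with hz
  have hy : μ • y k = G k (Δrow k z) := by
    rw [h k, hrow, map_sum]
    simp [hz]
  have hle : ‖μ‖ * ‖y k‖ ≤ ‖G k‖ * (r * ‖z‖) := by
    rw [← norm_smul, hy]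
    refine (G k).le_opNorm_of_le ?_
    exact (Δrow k).le_of_opNorm_le (hr k) z
  calc ‖μ‖ ^ 2 * ‖y k‖ ^ 2 = (‖μ‖ * ‖y k‖) ^ 2 := by ring
    _ ≤ (‖G k‖ * (r * ‖z‖)) ^ 2 := by gcongr
    _ = r ^ 2 * (‖G k‖ ^ 2 * ‖z‖ ^ 2) := by ring
    _ = r ^ 2 * ∑ l, (‖G k‖ ^ 2 * e k l ^ 2) * ‖y l‖ ^ 2 := by
      rw [PiLp.norm_sq_eq_of_L2, Finset.mul_sum]
      congr 1
      refine Finset.sum_congr rfl fun l _ => ?_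
      simp only [hz, norm_smul, Complex.norm_real, mul_pow, Real.norm_eq_abs, sq_abs]
      ring

/-- With `Θ² = sup_ω ρ(diag(‖G_k(iω)‖²) E^{∘2})` and a block perturbation `Δ` whose
block-row-norm maximum satisfies `‖Δ‖ < 1/Θ`, every eigenvalue `μ` of the matrix
`(e_{kl} G_k(iω) Δ_{kl})_{k,l}` (any `ω`) satisfies `|μ| ≤ ‖Δ‖ Θ < 1`; consequently `1`
is not in the closure of the union over `ω` of these spectra. -/
theorem eigenvalues_away_from_one
    {N : ℕ} (hN : 0 < N) (p m : Fin N → ℕ)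
    (G : ∀ k, ℝ → (EuclideanSpace ℂ (Fin (m k)) →L[ℂ] EuclideanSpace ℂ (Fin (p k))))
    (hGcont : ∀ k, Continuous (G k))
    (hGbdd : ∃ C : ℝ, ∀ k ω, ‖G k ω‖ ≤ C)
    (e : Fin N → Fin N → ℝ) (he : ∀ k l, 0 ≤ e k l)
    (Θ : ℝ) (hΘpos : 0 < Θ)
    (hΘ : ENNReal.ofReal (Θ ^ 2) =
      ⨆ ω : ℝ, spectralRadius ℂ
        ((Matrix.of fun k l : Fin N => ‖G k ω‖ ^ 2 * (e k l) ^ 2).map (Complex.ofReal)))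
    (Δ : ∀ k l, EuclideanSpace ℂ (Fin (p l)) →L[ℂ] EuclideanSpace ℂ (Fin (m k)))
    (Δrow : ∀ k, (PiLp 2 fun l => EuclideanSpace ℂ (Fin (p l))) →L[ℂ]
      EuclideanSpace ℂ (Fin (m k)))
    (hrow : ∀ k (y : PiLp 2 fun l => EuclideanSpace ℂ (Fin (p l))),
      Δrow k y = ∑ l, Δ k l (y l))
    (hΔ : (⨆ k, ‖Δrow k‖) < 1 / Θ) :
    (∀ (ω : ℝ) (μ : ℂ) (y : PiLp 2 fun l => EuclideanSpace ℂ (Fin (p l))), y ≠ 0 →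
        (∀ k, μ • y k = ∑ l, ((e k l : ℂ)) • (G k ω) ((Δ k l) (y l))) →
        ‖μ‖ ≤ (⨆ k, ‖Δrow k‖) * Θ) ∧
      (⨆ k, ‖Δrow k‖) * Θ < 1 ∧
      (1 : ℂ) ∉ closure (⋃ ω : ℝ,
        {μ : ℂ | ∃ y : PiLp 2 fun l => EuclideanSpace ℂ (Fin (p l)), y ≠ 0 ∧
          ∀ k, μ • y k = ∑ l, ((e k l : ℂ)) • (G k ω) ((Δ k l) (y l))}) := by
  set r : ℝ := ⨆ k, ‖Δrow k‖ with hr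
  have hrk : ∀ k, ‖Δrow k‖ ≤ r := le_ciSup (Set.finite_range _).bddAbove
  have hr0 : 0 ≤ r := (norm_nonneg _).trans (hrk ⟨0, hN⟩)
  have hlt : r * Θ < 1 := (lt_div_iff₀ hΘpos).1 hΔ
  have hbound : ∀ (ω : ℝ) (μ : ℂ) (y : PiLp 2 fun l => EuclideanSpace ℂ (Fin (p l))), y ≠ 0 →
      (∀ k, μ • y k = ∑ l, ((e k l : ℂ)) • (G k ω) ((Δ k l) (y l))) → ‖μ‖ ≤ r * Θ := by
    intro ω μ y hy0 hy
    have hcomp := norm_sq_mul_le_of_block_eigenvector (fun k => G k ω) e Δ Δrow hrow hrk hy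
    obtain ⟨k₀, hk₀⟩ : ∃ k, y k ≠ 0 := by
      by_contra! hall
      exact hy0 (PiLp.ext hall)
    rcases hr0.eq_or_lt with hr0 | hr0
    · have hμ := hcomp k₀
      rw [← hr0] at hμ ⊢
      have hyk : 0 < ‖y k₀‖ ^ 2 := by positivity
      have : ‖μ‖ ^ 2 ≤ 0 := le_of_mul_le_mul_right (by simpa using hμ) hyk
      simpa using this.antisymm (sq_nonneg _)
    · have hρ := ofReal_le_spectralRadius_of_mul_le_mulVec
        (A := Matrix.of fun k l : Fin N => ‖G k ω‖ ^ 2 * (e k l) ^ 2)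
        (fun k l => by simp only [Matrix.of_apply]; positivity)
        (v := fun k => ‖y k‖ ^ 2) (fun k => by positivity)
        (fun h0 => hk₀ (by simpa using congrFun h0 k₀))
        (c := ‖μ‖ ^ 2 / r ^ 2) (by positivity)
        (fun k => by
          rw [div_mul_eq_mul_div, div_le_iff₀' (by positivity)]
          exact hcomp k)
      have hle := hρ.trans
        ((le_iSup (fun ω : ℝ => spectralRadius ℂ
          ((Matrix.of fun k l : Fin N => ‖G k ω‖ ^ 2 * (e k l) ^ 2).map Complex.ofReal)) ω).trans
          hΘ.ge)
      rw [ENNReal.ofReal_le_ofReal_iff (by positivity), div_le_iff₀' (by positivity),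
        ← mul_pow] at hle
      exact (sq_le_sq₀ (norm_nonneg _) (by positivity)).1 hle
  refine ⟨hbound, hlt, fun hmem => ?_⟩
  have hsub := closure_minimal (t := Metric.closedBall (0 : ℂ) (r * Θ))
    (Set.iUnion_subset fun ω => by
      rintro μ ⟨y, hy0, hy⟩
      simpa using hbound ω μ y hy0 hy) Metric.isClosed_closedBall hmem
  rw [mem_closedBall_zero_iff, norm_one] at hsub
  exact hlt.not_ge hsub
end
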